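/- Let r be a spacelike reflection and J_r := i^{k(k+1)/2} γ(f₁)⋯γ(f_k) for a basis f₁, …, f_k of the (−1)-eigenspace of r with q(fᵢ, fⱼ) = −δᵢⱼ. Then for every v ∈ ℝⁿ one has the 'Wick rotation' identity ½ ((J_r γ(v))² + (γ(v) J_r)²) = (−1)^k q(v, rv) · 1 in Mat(d, ℂ); here q(v, rv) = g^r(v, v) where g^r := q(·, r·) is the Riemannian (positive definite) inner product associated with r, so q(v, rv) > 0 for v ≠ 0. -/

import Mathlib

open Matrix

section AnticommutingProducts

variable {R : Type*} [Ring R]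

theorem mul_list_prod_of_anticomm {x : R} {l : List R} (h : ∀ a ∈ l, x * a = -(a * x)) :
    x * l.prod = (-1) ^ l.length * (l.prod * x) := by
  induction l with
  | nil => simp
  | cons a l ih =>
    have hl := ih fun b hb => h b (List.mem_cons_of_mem _ hb)
    have hc : a * (-1 : R) ^ l.length = (-1) ^ l.length * a :=
      ((Commute.neg_one_right a).pow_right _).eq
    calc x * (a :: l).prod = -(a * (x * l.prod)) := by
          rw [List.prod_cons, ← mul_assoc, h a List.mem_cons_self, neg_mul, mul_assoc]
      _ = -((-1) ^ l.length * a * (l.prod * x)) := by rw [hl, ← mul_assoc a, hc]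
      _ = (-1) ^ (a :: l).length * ((a :: l).prod * x) := by
          simp [pow_succ, mul_assoc]

theorem mul_list_prod_of_mem_of_pairwise_anticomm {x : R} {l : List R}
    (h : l.Pairwise fun a b => a * b = -(b * a)) (hx : x ∈ l) :
    x * l.prod = -((-1) ^ l.length * (l.prod * x)) := by
  obtain ⟨s, t, rfl⟩ := List.append_of_mem hx
  rw [List.pairwise_append, List.pairwise_cons] at h
  obtain ⟨-, ⟨ht, -⟩, hst⟩ := h
  have h₁ := mul_list_prod_of_anticomm (x := x) (l := s) fun a ha => by
    rw [hst a ha x List.mem_cons_self, neg_neg]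
  have h₂ := mul_list_prod_of_anticomm ht
  have hc : ∀ (y : R) (m : ℕ), y * (-1 : R) ^ m = (-1) ^ m * y := fun y m =>
    ((Commute.neg_one_right y).pow_right m).eq
  calc x * (s ++ x :: t).prod = x * s.prod * (x * t.prod) := by simp [mul_assoc]
    _ = (-1) ^ s.length * (s.prod * x) * ((-1) ^ t.length * (t.prod * x)) := by rw [h₁, h₂]
    _ = (-1) ^ s.length * ((s.prod * x) * (-1) ^ t.length) * (t.prod * x) := by
        simp only [mul_assoc]
    _ = -((-1) ^ (s ++ x :: t).length * ((s ++ x :: t).prod * x)) := by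
        rw [hc]; simp [pow_add, pow_succ, mul_assoc]

theorem list_prod_mul_self_of_pairwise_anticomm {l : List R}
    (h : l.Pairwise fun a b => a * b = -(b * a)) (hsq : ∀ a ∈ l, a * a = -1) :
    l.prod * l.prod = (-1) ^ (l.length * (l.length + 1) / 2) := by
  induction l with
  | nil => simp
  | cons a l ih =>
    rw [List.pairwise_cons] at h
    have hl := ih h.2 fun b hb => hsq b (List.mem_cons_of_mem _ hb)
    have ha := mul_list_prod_of_anticomm h.1
    have hc : a * (-1 : R) ^ l.length = (-1) ^ l.length * a :=
      ((Commute.neg_one_right a).pow_right _).eq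
    have hsign : (-1 : R) ^ l.length * (-1) ^ l.length = 1 := by
      rw [← pow_add, Even.neg_one_pow ⟨_, rfl⟩]
    have ha' : l.prod * a = (-1) ^ l.length * (a * l.prod) := by
      rw [ha, ← mul_assoc, hsign, one_mul]
    have hexp : (l.length + 1) * (l.length + 1 + 1) / 2 =
        l.length * (l.length + 1) / 2 + (l.length + 1) := by
      rw [show (l.length + 1) * (l.length + 1 + 1) =
        l.length * (l.length + 1) + (l.length + 1) * 2 by ring,
        Nat.add_mul_div_right _ _ two_pos]
    calc (a :: l).prod * (a :: l).prod = a * (l.prod * a) * l.prod := by simp [mul_assoc]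
      _ = a * (-1) ^ l.length * a * (l.prod * l.prod) := by rw [ha']; simp only [mul_assoc]
      _ = (-1) ^ l.length * (a * a) * (l.prod * l.prod) := by rw [hc]; simp only [mul_assoc]
      _ = (-1) ^ ((a :: l).length * ((a :: l).length + 1) / 2) := by
        rw [hsq a List.mem_cons_self, hl, List.length_cons, hexp, ← pow_succ, ← pow_add,
          add_comm]

end AnticommutingProducts

section Clifford

variable {n d : ℕ}

/-- The linear extension `v ↦ ∑ i, v i • γ i` of a family of gamma matrices. -/
def cliffordMap (γ : Fin n → Matrix (Fin d) (Fin d) ℂ) :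
    (Fin n → ℝ) →ₗ[ℝ] Matrix (Fin d) (Fin d) ℂ where
  toFun v := ∑ i, (v i : ℂ) • γ i
  map_add' u v := by simp [add_smul, Finset.sum_add_distrib]
  map_smul' c v := by simp [Finset.smul_sum, mul_smul]

theorem cliffordMap_mul_add_mul (γ : Fin n → Matrix (Fin d) (Fin d) ℂ) (ε : Fin n → ℝ)
    (hcl : ∀ i j, γ i * γ j + γ j * γ i =
      ((2 : ℂ) * (if i = j then (ε i : ℂ) else 0)) • (1 : Matrix (Fin d) (Fin d) ℂ))
    (u v : Fin n → ℝ) :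
    cliffordMap γ u * cliffordMap γ v + cliffordMap γ v * cliffordMap γ u =
      ((2 : ℂ) * ((∑ i, ε i * (u i * v i) : ℝ) : ℂ)) • (1 : Matrix (Fin d) (Fin d) ℂ) := by
  have h₁ : cliffordMap γ u * cliffordMap γ v =
      ∑ i, ∑ j, ((u i : ℂ) * v j) • (γ i * γ j) := by
    simp [cliffordMap, Finset.sum_mul_sum, smul_smul, mul_comm, -Complex.coe_smul]
  have h₂ : cliffordMap γ v * cliffordMap γ u =
      ∑ i, ∑ j, ((u i : ℂ) * v j) • (γ j * γ i) := by
    rw [Finset.sum_comm]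
    simp [cliffordMap, Finset.sum_mul_sum, smul_smul, -Complex.coe_smul]
  rw [h₁, h₂]
  simp only [← Finset.sum_add_distrib, ← smul_add, hcl, smul_smul, ← Finset.sum_smul]
  congr 1
  simp only [mul_ite, mul_zero, Finset.sum_ite_eq, Finset.mem_univ, if_true]
  push_cast
  rw [Finset.mul_sum]
  exact Finset.sum_congr rfl fun i _ => by ring

end Clifford

/-- the 'Wick rotation' identity: for a spacelike reflection `r`
and `J_r := i^{k(k+1)/2} γ(f₁)⋯γ(f_k)`,
`½((J_r γ(v))² + (γ(v) J_r)²) = (−1)^k q(v, rv) · 1`, where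
`q(v, rv) = g^r(v,v)` is positive for `v ≠ 0`. -/
theorem wick_rotation_identity
    (n k d : ℕ) (hn : 1 ≤ n) (hkn : k ≤ n) (hd : 1 ≤ d)
    (q : (Fin n → ℝ) → (Fin n → ℝ) → ℝ)
    (hq : ∀ x y : Fin n → ℝ, q x y = ∑ i : Fin n, if (i : ℕ) < k then -(x i * y i) else x i * y i)
    (γ : Fin n → Matrix (Fin d) (Fin d) ℂ)
    (hcl : ∀ i j : Fin n, γ i * γ j + γ j * γ i =
      ((2 : ℂ) * (if i = j then (if (i : ℕ) < k then -1 else 1) else 0)) •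
        (1 : Matrix (Fin d) (Fin d) ℂ))
    -- `r` is a spacelike reflection
    (r : (Fin n → ℝ) →ₗ[ℝ] (Fin n → ℝ))
    (hr2 : ∀ v, r (r v) = v)
    (hrq : ∀ u v, q (r u) (r v) = q u v)
    (hrpos : ∀ v : Fin n → ℝ, v ≠ 0 → 0 < q v (r v))
    -- `f` is a `q`-orthonormal basis of the `(−1)`-eigenspace of `r`
    (f : Fin k → (Fin n → ℝ))
    (hfeig : ∀ j, r (f j) = -(f j))
    (hforth : ∀ i j, q (f i) (f j) = if i = j then -1 else 0)
    (hfspan : ∀ v : Fin n → ℝ, r v = -v → v ∈ Submodule.span ℝ (Set.range f))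
    (J : Matrix (Fin d) (Fin d) ℂ)
    (hJ : J = (Complex.I ^ (k * (k + 1) / 2)) •
      ((List.finRange k).map (fun j => ∑ i, (f j i : ℂ) • γ i)).prod) :
    (∀ v : Fin n → ℝ,
      ((1 : ℂ) / 2) •
        ((J * (∑ i, (v i : ℂ) • γ i)) * (J * (∑ i, (v i : ℂ) • γ i)) +
          ((∑ i, (v i : ℂ) • γ i) * J) * ((∑ i, (v i : ℂ) • γ i) * J)) =
        ((-1 : ℂ) ^ k * (q v (r v) : ℝ)) • (1 : Matrix (Fin d) (Fin d) ℂ)) ∧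
    (∀ v : Fin n → ℝ, v ≠ 0 → 0 < q v (r v)) := by
  refine ⟨fun v => ?_, hrpos⟩
  have hG : ∀ u v, cliffordMap γ u * cliffordMap γ v + cliffordMap γ v * cliffordMap γ u =
      ((2 : ℂ) * (q u v : ℝ)) • (1 : Matrix (Fin d) (Fin d) ℂ) := by
    intro u v
    rw [cliffordMap_mul_add_mul γ (fun i => if (i : ℕ) < k then -1 else 1)
      (fun i j => by rw [hcl]; push_cast [apply_ite Complex.ofReal]; rfl), hq]
    simp
  have hanti : ∀ u v, q u v = 0 →
      cliffordMap γ u * cliffordMap γ v = -(cliffordMap γ v * cliffordMap γ u) := by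
    intro u v h
    have := hG u v
    rw [h] at this
    exact eq_neg_of_add_eq_zero_left (by simpa using this)
  set l := (List.finRange k).map fun j => cliffordMap γ (f j) with hl
  have hlen : l.length = k := by simp [hl]
  have hpair : l.Pairwise fun a b => a * b = -(b * a) := by
    rw [hl, List.pairwise_map]
    exact (List.nodup_finRange k).imp fun {i j} hij => hanti _ _ (by rw [hforth, if_neg hij])
  have hsq : ∀ a ∈ l, a * a = -1 := by
    intro a ha
    obtain ⟨j, -, rfl⟩ := List.mem_map.1 ha
    have h := hG (f j) (f j)
    rw [hforth, if_pos rfl, ← two_smul ℂ, mul_smul] at h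
    simpa using smul_right_injective _ (two_ne_zero (α := ℂ)) h
  have hJl : J = Complex.I ^ (k * (k + 1) / 2) • l.prod := hJ
  have hJJ : J * J = 1 := by
    rw [hJl, smul_mul_smul_comm, list_prod_mul_self_of_pairwise_anticomm hpair hsq, hlen,
      ← mul_pow, Complex.I_mul_I]
    rw [show (-1 : Matrix (Fin d) (Fin d) ℂ) = (-1 : ℂ) • 1 by simp, smul_pow, one_pow,
      smul_smul, ← mul_pow]
    simp
  have hcomm : ∀ v, cliffordMap γ v * l.prod = (-1) ^ k * (l.prod * cliffordMap γ (r v)) := by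
    have hneg : ∀ w ∈ Submodule.span ℝ (Set.range f),
        cliffordMap γ w * l.prod = -((-1) ^ k * (l.prod * cliffordMap γ w)) := by
      intro w hw
      induction hw using Submodule.span_induction with
      | mem w hw =>
        obtain ⟨j, rfl⟩ := hw
        have h := mul_list_prod_of_mem_of_pairwise_anticomm hpair
          (List.mem_map.2 ⟨j, List.mem_finRange j, rfl⟩)
        rwa [hlen] at h
      | zero => simp
      | add a b _ _ ha hb =>
        rw [map_add, add_mul, ha, hb, mul_add, mul_add, neg_add]
      | smul c a _ ha => simp [ha]
    have hpos : ∀ w, r w = w →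
        cliffordMap γ w * l.prod = (-1) ^ k * (l.prod * cliffordMap γ w) := by
      intro w hw
      rw [← hlen]
      refine mul_list_prod_of_anticomm fun a ha => ?_
      obtain ⟨j, -, rfl⟩ := List.mem_map.1 ha
      refine hanti _ _ ?_
      have h := hrq w (f j)
      have hqneg : q w (-(f j)) = -q w (f j) := by
        simp only [hq, ← Finset.sum_neg_distrib]
        exact Finset.sum_congr rfl fun i _ => by split_ifs <;> simp
      rw [hw, hfeig, hqneg] at h
      linarith
    intro v
    have h₁ := hpos ((2 : ℝ)⁻¹ • (v + r v)) (by rw [map_smul, map_add, hr2, add_comm])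
    have h₂ := hneg ((2 : ℝ)⁻¹ • (v - r v))
      (hfspan _ (by rw [map_smul, map_sub, hr2, ← smul_neg, neg_sub]))
    have hv : v = (2 : ℝ)⁻¹ • (v + r v) + (2 : ℝ)⁻¹ • (v - r v) := by module
    have hrv : r v = (2 : ℝ)⁻¹ • (v + r v) - (2 : ℝ)⁻¹ • (v - r v) := by module
    calc cliffordMap γ v * l.prod
        = cliffordMap γ ((2 : ℝ)⁻¹ • (v + r v)) * l.prod +
          cliffordMap γ ((2 : ℝ)⁻¹ • (v - r v)) * l.prod := by
          rw [← add_mul, ← map_add, ← hv]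
      _ = (-1) ^ k * (l.prod * cliffordMap γ (r v)) := by
          rw [h₁, h₂, ← sub_eq_add_neg, ← mul_sub, ← mul_sub, ← map_sub, ← hrv]
  have hJcomm : ∀ v, cliffordMap γ v * J = (-1 : ℂ) ^ k • (J * cliffordMap γ (r v)) := by
    intro v
    rw [hJl, mul_smul_comm, hcomm, smul_mul_assoc, smul_comm,
      show (-1 : Matrix (Fin d) (Fin d) ℂ) = (-1 : ℂ) • 1 by simp, smul_pow, one_pow,
      smul_one_mul]
  change ((1 : ℂ) / 2) • ((J * cliffordMap γ v) * (J * cliffordMap γ v) +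
    (cliffordMap γ v * J) * (cliffordMap γ v * J)) = _
  have h₁ : (J * cliffordMap γ v) * (J * cliffordMap γ v) =
      (-1 : ℂ) ^ k • (cliffordMap γ (r v) * cliffordMap γ v) := by
    rw [mul_assoc, ← mul_assoc (cliffordMap γ v), hJcomm, smul_mul_assoc, mul_smul_comm,
      mul_assoc, ← mul_assoc J, hJJ, one_mul]
  have h₂ : (cliffordMap γ v * J) * (cliffordMap γ v * J) =
      (-1 : ℂ) ^ k • (cliffordMap γ v * cliffordMap γ (r v)) := by
    rw [hJcomm v, mul_smul_comm, ← hJcomm v,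
      mul_assoc, ← mul_assoc J, hJJ, one_mul]
  rw [h₁, h₂, ← smul_add, add_comm, hG, smul_smul, smul_smul]
  congr 1
  ring
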